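/- arXiv:1810.08657 — 4 statements merged into one kernel-verified Lean document; each statement's English description precedes it below -/
import Mathlib

section
/- Let G be a finite simple graph of order n ≥ 2. Then CR(G) ≤ n − 2. -/
open SimpleGraph Set

/-- The closed neighborhood `N[v]` of a vertex `v`. -/
def closedNbhd {V : Type*} (G : SimpleGraph V) (v : V) : Set V :=
  insert v (G.neighborSet v)

/-- `S` is a dominating set of `G`: every vertex lies in `N[s]` for some `s ∈ S`. -/
def IsDomSet {V : Type*} (G : SimpleGraph V) (S : Set V) : Prop :=
  ∀ v : V, ∃ s ∈ S, v ∈ closedNbhd G s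

/-- `CR(S)`: the number of vertices overdominated by `S`, i.e. with `|N[x] ∩ S| ≥ 2`. -/
noncomputable def crOf {V : Type*} (G : SimpleGraph V) (S : Set V) : ℕ :=
  {x : V | 2 ≤ (closedNbhd G x ∩ S).ncard}.ncard

/-- `CR(G)`: the minimum of `CR(S)` over all dominating sets `S` of `G`. -/
noncomputable def crNum {V : Type*} (G : SimpleGraph V) : ℕ :=
  sInf {k : ℕ | ∃ S : Set V, IsDomSet G S ∧ crOf G S = k}

/-- `γ_CR(G)`: the minimum cardinality of a dominating set `S` with `CR(S) = CR(G)`. -/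
noncomputable def gammaCR {V : Type*} (G : SimpleGraph V) : ℕ :=
  sInf {r : ℕ | ∃ S : Set V, IsDomSet G S ∧ crOf G S = crNum G ∧ S.ncard = r}

theorem mem_closedNbhd_comm {V : Type*} {G : SimpleGraph V} {u v : V} :
    u ∈ closedNbhd G v ↔ v ∈ closedNbhd G u := by
  simp only [closedNbhd, Set.mem_insert_iff, mem_neighborSet, G.adj_comm u v, eq_comm]

/-- Every element of a minimal dominating set has a private neighbor. -/
theorem exists_private_neighbor_of_minimal {V : Type*} {G : SimpleGraph V} {S : Set V}
    (hS : Minimal (IsDomSet G) S) {a : V} (ha : a ∈ S) : ∃ v, closedNbhd G v ∩ S = {a} := by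
  have hnot : ¬ IsDomSet G (S \ {a}) := fun h => (hS.2 h Set.sdiff_subset ha).2 rfl
  simp only [IsDomSet, not_forall, not_exists, not_and] at hnot
  obtain ⟨v, hv⟩ := hnot
  have huniq : ∀ s ∈ S, v ∈ closedNbhd G s → s = a := fun s hs hvs => by
    by_contra hsa
    exact hv s ⟨hs, hsa⟩ hvs
  obtain ⟨s, hs, hvs⟩ := hS.1 v
  obtain rfl := huniq s hs hvs
  refine ⟨v, Set.eq_singleton_iff_unique_mem.2 ⟨⟨mem_closedNbhd_comm.1 hvs, hs⟩, ?_⟩⟩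
  exact fun t ht => huniq t ht.2 (mem_closedNbhd_comm.1 ht.1)

theorem crNum_le_crOf {V : Type*} {G : SimpleGraph V} {S : Set V} (hS : IsDomSet G S) :
    crNum G ≤ crOf G S :=
  Nat.sInf_le ⟨S, hS, rfl⟩

theorem crOf_eq_zero_of_subsingleton {V : Type*} (G : SimpleGraph V) {S : Set V}
    (hS : S.Subsingleton) : crOf G S = 0 := by
  have hempty : {x : V | 2 ≤ (closedNbhd G x ∩ S).ncard} = ∅ := by
    refine Set.eq_empty_of_forall_notMem fun x hx => ?_
    have hsub := hS.anti (Set.inter_subset_right (s := closedNbhd G x))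
    have := hsub.finite.to_subtype
    exact absurd (Set.ncard_le_one_iff_subsingleton.2 hsub) (not_le.2 hx)
  rw [crOf, hempty, Set.ncard_empty]

/-- A minimal dominating set with two elements leaves two vertices not overdominated. -/
theorem crOf_le_card_sub_two_of_minimal {V : Type*} [Fintype V] {G : SimpleGraph V} {S : Set V}
    (hS : Minimal (IsDomSet G) S) (hnt : S.Nontrivial) : crOf G S ≤ Fintype.card V - 2 := by
  obtain ⟨a, ha, b, hb, hab⟩ := hnt
  obtain ⟨v, hv⟩ := exists_private_neighbor_of_minimal hS ha
  obtain ⟨w, hw⟩ := exists_private_neighbor_of_minimal hS hb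
  have hvw : v ≠ w := by
    rintro rfl
    exact hab (Set.singleton_injective (hv.symm.trans hw))
  have hsub : {x : V | 2 ≤ (closedNbhd G x ∩ S).ncard} ⊆ ({v, w} : Set V)ᶜ := by
    rintro x hx (rfl | rfl)
    · simp [hv] at hx
    · simp [hw] at hx
  calc crOf G S ≤ (({v, w} : Set V)ᶜ).ncard := Set.ncard_le_ncard hsub
    _ = Fintype.card V - 2 := by
      rw [Set.ncard_compl, Set.ncard_pair hvw, Nat.card_eq_fintype_card]

theorem crNum_le_card_sub_two {V : Type*} [Fintype V] (G : SimpleGraph V)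
    (hn : 2 ≤ Fintype.card V) :
    crNum G ≤ Fintype.card V - 2 := by
  have huniv : IsDomSet G Set.univ := fun v => ⟨v, Set.mem_univ v, Set.mem_insert v _⟩
  obtain ⟨S, -, hS⟩ := (Set.toFinite {S | IsDomSet G S}).exists_le_minimal huniv
  refine (crNum_le_crOf hS.1).trans ?_
  rcases S.subsingleton_or_nontrivial with hsub | hnt
  · simp [crOf_eq_zero_of_subsingleton G hsub]
  · exact crOf_le_card_sub_two_of_minimal hS hnt
end

section
/- Let G be a finite simple graph of order n ≥ 4. Then CR(G) = n − 2 if and only if n is even and every vertex of G has degree n − 2. -/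
open SimpleGraph Set

theorem mem_closedNbhd {V : Type*} {G : SimpleGraph V} {v x : V} :
    x ∈ closedNbhd G v ↔ x = v ∨ G.Adj v x := Iff.rfl

theorem mem_closedNbhd_iff_notMem_compl_neighborSet {V : Type*} {G : SimpleGraph V} {v x : V} :
    x ∈ closedNbhd G v ↔ x ∉ Gᶜ.neighborSet v := by
  simp only [mem_closedNbhd, mem_neighborSet, compl_adj]
  grind

theorem ncard_neighborSet_add_ncard_compl {V : Type*} [Fintype V] (G : SimpleGraph V) (v : V) :
    (G.neighborSet v).ncard + (Gᶜ.neighborSet v).ncard + 1 = Fintype.card V := by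
  classical
  have h1 := G.degree_compl v
  have h2 := G.degree_lt_card_verts v
  simp only [← coe_neighborFinset, ncard_coe_finset, card_neighborFinset_eq_degree]
  omega

theorem crOf_add_ncard {V : Type*} [Fintype V] (G : SimpleGraph V) (S : Set V) :
    crOf G S + {x : V | (closedNbhd G x ∩ S).ncard ≤ 1}.ncard = Fintype.card V := by
  have h := ncard_add_ncard_compl {x : V | 2 ≤ (closedNbhd G x ∩ S).ncard}
  rw [Nat.card_eq_fintype_card] at h
  rw [← h, crOf]
  congr 2
  ext x
  simp only [mem_ofPred_eq, mem_compl_iff]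
  omega

/-- Vertices that are not overdominated by a dominating set bound `CR(G)` from above. -/
theorem crNum_add_ncard_le {V : Type*} [Fintype V] {G : SimpleGraph V} {S T : Set V}
    (hS : IsDomSet G S) (hT : ∀ x ∈ T, (closedNbhd G x ∩ S).ncard ≤ 1) :
    crNum G + T.ncard ≤ Fintype.card V := by
  rw [← crOf_add_ncard G S]
  exact Nat.add_le_add (Nat.sInf_le ⟨S, hS, rfl⟩) (ncard_le_ncard hT)

theorem ncard_closedNbhd_inter_le_one_of_isIndepSet {V : Type*} {G : SimpleGraph V} {S : Set V}
    (hS : G.IsIndepSet S) {x : V} (hx : x ∈ S) : (closedNbhd G x ∩ S).ncard ≤ 1 := by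
  rw [← ncard_singleton x]
  refine ncard_le_ncard ?_
  rintro y ⟨rfl | hy, hyS⟩
  · rfl
  · exact absurd hy (hS hx hyS hy.ne)

theorem isDomSet_of_maximal_isIndepSet {V : Type*} {G : SimpleGraph V} {S : Set V}
    (hS : Maximal G.IsIndepSet S) : IsDomSet G S := by
  intro v
  by_contra! h
  simp only [mem_closedNbhd, not_or] at h
  have hv : G.IsIndepSet (insert v S) :=
    hS.prop.insert fun s hs _ => ⟨fun e => (h s hs).2 e.symm, (h s hs).2⟩
  exact (h v (hS.le_of_ge hv (subset_insert v S) (mem_insert v S))).1 rfl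

/-- A vertex with two non-neighbors forces `CR(G) ≤ n - 3`. -/
theorem crNum_add_three_le {V : Type*} [Fintype V] {G : SimpleGraph V} {v a b : V}
    (ha : Gᶜ.Adj v a) (hb : Gᶜ.Adj v b) (hab : a ≠ b) : crNum G + 3 ≤ Fintype.card V := by
  have hI : G.IsIndepSet {v, a} :=
    pairwise_pair.2 fun _ => ⟨ha.2, fun h => ha.2 h.symm⟩
  obtain ⟨S, hle, hS⟩ := Set.Finite.exists_le_maximal (toFinite {S | G.IsIndepSet S}) hI
  have hv : v ∈ S := hle (by simp)
  have haS : a ∈ S := hle (by simp)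
  have hind := fun x (hx : x ∈ S) => ncard_closedNbhd_inter_le_one_of_isIndepSet hS.prop hx
  obtain ⟨c, hcv, hca, hc⟩ : ∃ c, v ≠ c ∧ a ≠ c ∧ (closedNbhd G c ∩ S).ncard ≤ 1 := by
    by_cases h : ∃ c ∈ S, v ≠ c ∧ a ≠ c
    · obtain ⟨c, hcS, hcv, hca⟩ := h
      exact ⟨c, hcv, hca, hind c hcS⟩
    · push Not at h
      refine ⟨b, hb.ne, hab, ?_⟩
      rw [← ncard_singleton a]
      refine ncard_le_ncard ?_
      rintro y ⟨hy, hyS⟩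
      by_contra hya
      obtain rfl : v = y := by
        by_contra hvy
        exact hya (h y hyS hvy).symm
      exact mem_closedNbhd_iff_notMem_compl_neighborSet.1 hy hb.symm
  have h3 : ({v, a, c} : Set V).ncard = 3 := ncard_eq_three.2 ⟨v, a, c, ha.ne, hcv, hca, rfl⟩
  rw [← h3]
  refine crNum_add_ncard_le (isDomSet_of_maximal_isIndepSet hS) ?_
  rintro x (rfl | rfl | rfl)
  exacts [hind _ hv, hind _ haS, hc]

theorem crNum_eq_zero_of_compl_neighborSet_eq_empty {V : Type*} {G : SimpleGraph V}
    {v : V} (h : Gᶜ.neighborSet v = ∅) : crNum G = 0 := by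
  refine Nat.eq_zero_of_le_zero (Nat.sInf_le ⟨{v}, fun x => ⟨v, rfl, ?_⟩, ?_⟩)
  · simp [mem_closedNbhd_iff_notMem_compl_neighborSet, h]
  · have hx (x : V) : ¬ 2 ≤ (closedNbhd G x ∩ {v}).ncard := by
      have := ncard_le_ncard (inter_subset_right : closedNbhd G x ∩ {v} ⊆ {v})
      rw [ncard_singleton] at this
      omega
    simp [crOf, hx]

theorem ncard_compl_neighborSet_eq_one {V : Type*} [Fintype V] {G : SimpleGraph V}
    (hn : 3 ≤ Fintype.card V) (h : crNum G = Fintype.card V - 2) (v : V) :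
    (Gᶜ.neighborSet v).ncard = 1 := by
  have h0 : (Gᶜ.neighborSet v).ncard ≠ 0 := by
    rw [Ne, ncard_eq_zero]
    intro h0
    have := crNum_eq_zero_of_compl_neighborSet_eq_empty h0
    omega
  have h2 : (Gᶜ.neighborSet v).ncard ≤ 1 := by
    by_contra! h2
    obtain ⟨a, b, ha, hb, hab⟩ := (one_lt_ncard_iff).1 h2
    have := crNum_add_three_le ha hb hab
    omega
  omega

theorem even_card_of_ncard_neighborSet_eq_one {V : Type*} [Fintype V] {H : SimpleGraph V}
    (h : ∀ v, (H.neighborSet v).ncard = 1) : Even (Fintype.card V) := by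
  classical
  have hd (v : V) : H.degree v = 1 := by
    simpa only [← coe_neighborFinset, ncard_coe_finset, card_neighborFinset_eq_degree] using h v
  simpa [hd] using H.even_card_odd_degree_vertices

/-- If every vertex has exactly one non-neighbor, a dominating set overdominates all but at most
two vertices. -/
theorem card_le_crOf_add_two {V : Type*} [Fintype V] {G : SimpleGraph V}
    {f : V → V} (hf : ∀ v, Gᶜ.neighborSet v = {f v}) {S : Set V} (hV : Nonempty V)
    (hS : IsDomSet G S) : Fintype.card V ≤ crOf G S + 2 := by
  have hN (v x : V) : x ∈ closedNbhd G v ↔ x ≠ f v := by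
    rw [mem_closedNbhd_iff_notMem_compl_neighborSet, hf, mem_singleton_iff]
  have hadj (v : V) : Gᶜ.Adj v (f v) := by
    rw [← mem_neighborSet, hf]
    rfl
  have hff (v : V) : f (f v) = v := by
    have : v ∈ Gᶜ.neighborSet (f v) := (hadj v).symm
    rw [hf] at this
    exact this.symm
  have hS2 : 2 ≤ S.ncard := by
    obtain ⟨s, hs, -⟩ := hS hV.some
    obtain ⟨t, ht, hst⟩ := hS (f s)
    refine (one_lt_ncard_iff).2 ⟨s, t, hs, ht, ?_⟩
    rintro rfl
    exact (hN _ _).1 hst rfl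
  rw [← crOf_add_ncard G S]
  refine Nat.add_le_add_left ?_ _
  set U := {x : V | (closedNbhd G x ∩ S).ncard ≤ 1} with hU
  rcases U.eq_empty_or_nonempty with h | ⟨x, hx⟩
  · simp [h]
  have hmaps : ∀ x ∈ U, f x ∈ S := by
    intro x hx
    by_contra hfx
    have : closedNbhd G x ∩ S = S :=
      inter_eq_right.2 fun y hy => (hN x y).2 fun e => hfx (e ▸ hy)
    rw [hU, mem_ofPred_eq, this] at hx
    omega
  have hUS : U.ncard ≤ S.ncard :=
    ncard_le_ncard_of_injOn f hmaps (Function.LeftInverse.injective hff).injOn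
  have hsub : S ⊆ insert (f x) (closedNbhd G x ∩ S) := by
    intro y hy
    by_cases e : y = f x
    · exact Or.inl e
    · exact Or.inr ⟨(hN x y).2 e, hy⟩
  have h1 := ncard_le_ncard hsub
  have h2 := ncard_insert_le (f x) (closedNbhd G x ∩ S)
  have h3 : (closedNbhd G x ∩ S).ncard ≤ 1 := hx
  omega

theorem crNum_eq_of_ncard_compl_neighborSet_eq_one {V : Type*} [Fintype V] [Nonempty V]
    {G : SimpleGraph V} (h : ∀ v, (Gᶜ.neighborSet v).ncard = 1) :
    crNum G = Fintype.card V - 2 := by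
  choose f hf using fun v => ncard_eq_one.1 (h v)
  obtain ⟨v⟩ := ‹Nonempty V›
  have hadj : Gᶜ.Adj v (f v) := by
    rw [← mem_neighborSet, hf]
    rfl
  have hI : G.IsIndepSet {v, f v} :=
    pairwise_pair.2 fun _ => ⟨hadj.2, fun h => hadj.2 h.symm⟩
  have hD : IsDomSet G {v, f v} := by
    intro x
    by_cases hx : x = f v
    · exact ⟨f v, by simp, Or.inl hx⟩
    · refine ⟨v, by simp, ?_⟩
      rwa [mem_closedNbhd_iff_notMem_compl_neighborSet, hf]
  have hle := crNum_add_ncard_le hD fun x hx =>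
    ncard_closedNbhd_inter_le_one_of_isIndepSet hI hx
  rw [ncard_pair hadj.ne] at hle
  obtain ⟨S, hS, hSc⟩ := Nat.sInf_mem (s := {k | ∃ S : Set V, IsDomSet G S ∧ crOf G S = k})
    ⟨_, _, hD, rfl⟩
  change crOf G S = crNum G at hSc
  have hge := card_le_crOf_add_two hf ⟨v⟩ hS
  omega

theorem crNum_eq_card_sub_two_iff {V : Type*} [Fintype V] (G : SimpleGraph V)
    (hn : 4 ≤ Fintype.card V) :
    crNum G = Fintype.card V - 2 ↔
      Even (Fintype.card V) ∧
        ∀ v : V, (G.neighborSet v).ncard = Fintype.card V - 2 := by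
  have : Nonempty V := Fintype.card_pos_iff.1 (by omega)
  constructor
  · intro h
    have h1 := ncard_compl_neighborSet_eq_one (by omega) h
    refine ⟨even_card_of_ncard_neighborSet_eq_one h1, fun v => ?_⟩
    have := ncard_neighborSet_add_ncard_compl G v
    have := h1 v
    omega
  · rintro ⟨-, h⟩
    refine crNum_eq_of_ncard_compl_neighborSet_eq_one fun v => ?_
    have := ncard_neighborSet_add_ncard_compl G v
    have := h v
    omega
end

section
/- Let n, m, and r be integers with n ≥ 2, 0 ≤ m ≤ C(n, 2), r ≥ 1, and C(r, 2) < m ≤ C(r+1, 2). Then every finite simple graph G of order n with m edges and CR(G) = 0 satisfies γ_CR(G) ≤ n − r, and there exists a finite simple graph G of order n with m edges, CR(G) = 0, and γ_CR(G) = n − r. In other words, D(n,0,m) = n − r. -/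
open SimpleGraph Set

/-- `S` is a perfect code of `G`: every vertex lies in `N[s]` for exactly one `s ∈ S`. -/
def IsPerfectCode {V : Type*} (G : SimpleGraph V) (S : Set V) : Prop :=
  ∀ v : V, ∃! s, s ∈ S ∧ v ∈ closedNbhd G s

theorem mem_closedNbhd_iff {V : Type*} {G : SimpleGraph V} {u v : V} :
    u ∈ closedNbhd G v ↔ u = v ∨ G.Adj v u := by
  simp [closedNbhd]

theorem isPerfectCode_iff {V : Type*} [Finite V] {G : SimpleGraph V} {S : Set V} :
    IsPerfectCode G S ↔ IsDomSet G S ∧ crOf G S = 0 := by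
  have hcr : crOf G S = 0 ↔ ∀ x, (closedNbhd G x ∩ S).ncard ≤ 1 := by
    rw [crOf, Set.ncard_eq_zero, Set.eq_empty_iff_forall_notMem]
    simp only [Set.mem_ofPred_eq, not_le, Nat.lt_succ_iff]
  rw [hcr]
  constructor
  · intro h
    refine ⟨fun v => (h v).exists, fun x => ?_⟩
    rw [Set.ncard_le_one]
    rintro a ⟨ha, haS⟩ b ⟨hb, hbS⟩
    exact (h x).unique ⟨haS, mem_closedNbhd_comm.1 ha⟩ ⟨hbS, mem_closedNbhd_comm.1 hb⟩
  · rintro ⟨hd, hc⟩ v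
    obtain ⟨s, hs, hv⟩ := hd v
    refine ⟨s, ⟨hs, hv⟩, ?_⟩
    rintro t ⟨ht, hvt⟩
    exact (Set.ncard_le_one (Set.toFinite _)).1 (hc v) t ⟨mem_closedNbhd_comm.1 hvt, ht⟩ s
      ⟨mem_closedNbhd_comm.1 hv, hs⟩

theorem IsPerfectCode.crNum_eq_zero {V : Type*} [Finite V] {G : SimpleGraph V} {S : Set V}
    (h : IsPerfectCode G S) : crNum G = 0 :=
  Nat.le_zero.1 (Nat.sInf_le ⟨S, isPerfectCode_iff.1 h⟩)

theorem exists_isPerfectCode {V : Type*} [Finite V] {G : SimpleGraph V} (h : crNum G = 0) :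
    ∃ S, IsPerfectCode G S := by
  have hne : {k : ℕ | ∃ S : Set V, IsDomSet G S ∧ crOf G S = k}.Nonempty :=
    ⟨_, Set.univ, fun v => ⟨v, Set.mem_univ v, mem_closedNbhd_iff.2 (Or.inl rfl)⟩, rfl⟩
  obtain ⟨S, hS, hc⟩ := Nat.sInf_mem hne
  exact ⟨S, isPerfectCode_iff.2 ⟨hS, hc.trans h⟩⟩

theorem IsPerfectCode.ncard_le {V : Type*} [Finite V] {G : SimpleGraph V} {S T : Set V}
    (hS : IsPerfectCode G S) (hT : IsPerfectCode G T) : T.ncard ≤ S.ncard := by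
  choose f hf using fun v => (hS v).exists
  refine Set.ncard_le_ncard_of_injOn f (fun t _ => (hf t).1) fun a ha b hb hab => ?_
  exact (hT (f a)).unique ⟨ha, mem_closedNbhd_comm.1 (hf a).2⟩
    ⟨hb, mem_closedNbhd_comm.1 (hab ▸ (hf b).2)⟩

theorem IsPerfectCode.gammaCR_eq {V : Type*} [Finite V] {G : SimpleGraph V} {S : Set V}
    (h : IsPerfectCode G S) : gammaCR G = S.ncard := by
  have hmem : S.ncard ∈ {r : ℕ | ∃ S : Set V, IsDomSet G S ∧ crOf G S = crNum G ∧
      S.ncard = r} := by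
    rw [h.crNum_eq_zero]
    exact ⟨S, (isPerfectCode_iff.1 h).1, (isPerfectCode_iff.1 h).2, rfl⟩
  refine le_antisymm (Nat.sInf_le hmem) (le_csInf ⟨_, hmem⟩ ?_)
  rintro _ ⟨T, hT, hc, rfl⟩
  rw [h.crNum_eq_zero] at hc
  exact (isPerfectCode_iff.2 ⟨hT, hc⟩).ncard_le h

/-- Edges inside the complement of a perfect code are counted by off-diagonal pairs of the
complement, the remaining ones by diagonal pairs. -/
theorem IsPerfectCode.ncard_edgeSet_le {V : Type*} [Finite V] {G : SimpleGraph V} {S : Set V}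
    (h : IsPerfectCode G S) : G.edgeSet.ncard ≤ (Sᶜ.ncard + 1).choose 2 := by
  classical
  have := Fintype.ofFinite V
  choose f hf using fun v => (h v).exists
  have huniq : ∀ v s, s ∈ S → v ∈ closedNbhd G s → s = f v := fun v s hs hv =>
    (h v).unique ⟨hs, hv⟩ (hf v)
  let g : Sym2 V → Sym2 V := Sym2.lift ⟨fun a b => if a = b then s(a, f a) else s(a, b), by
    intro a b
    by_cases hab : a = b
    · subst hab; rfl
    · simp [hab, Ne.symm hab, Sym2.eq_swap]⟩
  have hdiag : ∀ a, g s(a, a) = s(a, f a) := fun a => by simp [g]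
  have hoff : ∀ a b, a ≠ b → g s(a, b) = s(a, b) := fun a b hab => by simp [g, hab]
  have hsub : G.edgeSet ⊆ ((Sᶜ.toFinset.sym2.image g : Finset (Sym2 V)) : Set (Sym2 V)) := by
    intro e
    induction e with | _ a b
    intro hab
    rw [SimpleGraph.mem_edgeSet] at hab
    rw [Finset.mem_coe, Finset.mem_image]
    by_cases ha : a ∈ S
    · have hb : b ∉ S := fun hb => hab.ne <|
        (huniq b a ha (mem_closedNbhd_iff.2 (Or.inr hab))).trans
          (huniq b b hb (mem_closedNbhd_iff.2 (Or.inl rfl))).symm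
      refine ⟨s(b, b), by simp [hb], ?_⟩
      rw [hdiag, ← huniq b a ha (mem_closedNbhd_iff.2 (Or.inr hab)), Sym2.eq_swap]
    · by_cases hb : b ∈ S
      · refine ⟨s(a, a), by simp [ha], ?_⟩
        rw [hdiag, ← huniq a b hb (mem_closedNbhd_iff.2 (Or.inr hab.symm))]
      · exact ⟨s(a, b), by simp [ha, hb], hoff a b hab.ne⟩
  calc G.edgeSet.ncard ≤ (Sᶜ.toFinset.sym2.image g).card := by
        rw [← Set.ncard_coe_finset]; exact Set.ncard_le_ncard hsub
    _ ≤ Sᶜ.toFinset.sym2.card := Finset.card_image_le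
    _ = (Sᶜ.ncard + 1).choose 2 := by rw [Finset.card_sym2, Set.ncard_eq_toFinset_card']

theorem le_choose_two_add_one (r : ℕ) : r ≤ r.choose 2 + 1 := by
  cases r with
  | zero => simp
  | succ k =>
    rw [Nat.choose_succ_succ' k 1, Nat.choose_one_right]
    omega

/-- Perfect code in a graph whose edges span only vertices of index at most `r` and which contains
the star joining `0` to the other such vertices. -/
theorem isPerfectCode_of_star {n r : ℕ} [NeZero n] {G : SimpleGraph (Fin n)}
    (hstar : ∀ v : Fin n, v ≠ 0 → v.val ≤ r → G.Adj 0 v)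
    (hle : ∀ u v, G.Adj u v → u.val ≤ r) :
    IsPerfectCode G {v | v ≠ 0 ∧ v.val ≤ r}ᶜ := by
  have hS : ∀ s : Fin n, s ∈ ({v | v ≠ 0 ∧ v.val ≤ r}ᶜ : Set (Fin n)) → s.val ≤ r → s = 0 :=
    fun s hs hsr => by_contra fun h0 => hs ⟨h0, hsr⟩
  intro v
  by_cases hv : v.val ≤ r
  · refine ⟨0, ⟨fun h => h.1 rfl, mem_closedNbhd_iff.2 ?_⟩, ?_⟩
    · by_cases h0 : v = 0
      · exact Or.inl h0
      · exact Or.inr (hstar v h0 hv)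
    · rintro s ⟨hs, hvs⟩
      rcases mem_closedNbhd_iff.1 hvs with rfl | hadj
      · exact hS _ hs hv
      · exact hS s hs (hle s v hadj)
  · refine ⟨v, ⟨fun h => hv h.2, mem_closedNbhd_iff.2 (Or.inl rfl)⟩, ?_⟩
    rintro s ⟨-, hvs⟩
    rcases mem_closedNbhd_iff.1 hvs with rfl | hadj
    · rfl
    · exact absurd (hle v s hadj.symm) hv

theorem exists_graph_isPerfectCode {n m r : ℕ} (hrn : r < n) (hrm : r ≤ m)
    (hm : m ≤ (r + 1).choose 2) :
    ∃ (G : SimpleGraph (Fin n)) (S : Set (Fin n)),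
      G.edgeSet.ncard = m ∧ IsPerfectCode G S ∧ S.ncard = n - r := by
  classical
  have : NeZero n := ⟨by omega⟩
  let K : Finset (Fin n) := Finset.univ.filter fun v => v.val ≤ r
  have hK : K.card = r + 1 := by
    have : K = Finset.Iic ⟨r, hrn⟩ := by ext v; simp [K, Fin.le_def]
    rw [this, Fin.card_Iic]
  have h0K : (0 : Fin n) ∈ K := by simp [K]
  have hT : (K.erase 0).card = r := by rw [Finset.card_erase_of_mem h0K, hK]; rfl
  let star : Finset (Sym2 (Fin n)) := (K.erase 0).image fun v => s(0, v)
  let top : Finset (Sym2 (Fin n)) := K.offDiag.image Sym2.mk.uncurry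
  have hsub : star ⊆ top := by
    intro e he
    obtain ⟨v, hv, rfl⟩ := Finset.mem_image.1 he
    obtain ⟨hv0, hvK⟩ := Finset.mem_erase.1 hv
    exact Finset.mem_image.2 ⟨(0, v), Finset.mem_offDiag.2 ⟨h0K, hvK, hv0.symm⟩, rfl⟩
  have hstar : star.card ≤ m := Finset.card_image_le.trans (hT.le.trans hrm)
  have htop : m ≤ top.card := by
    rw [Sym2.card_image_offDiag, hK]; exact hm
  obtain ⟨E, hsE, hEt, hE⟩ := Finset.exists_subsuperset_card_eq hsub hstar htop
  have hEK : ∀ u v, s(u, v) ∈ E → u ∈ K ∧ v ∈ K ∧ u ≠ v := by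
    intro u v huv
    obtain ⟨⟨a, b⟩, hab, he⟩ := Finset.mem_image.1 (hEt huv)
    obtain ⟨ha, hb, hne⟩ := Finset.mem_offDiag.1 hab
    rcases Sym2.eq_iff.1 he with ⟨rfl, rfl⟩ | ⟨rfl, rfl⟩
    · exact ⟨ha, hb, hne⟩
    · exact ⟨hb, ha, hne.symm⟩
  have hedge : (fromEdgeSet (E : Set (Sym2 (Fin n)))).edgeSet = E := by
    ext e
    induction e with | _ a b
    rw [SimpleGraph.mem_edgeSet, fromEdgeSet_adj]
    exact ⟨And.left, fun h => ⟨h, (hEK a b h).2.2⟩⟩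
  refine ⟨fromEdgeSet E, {v | v ≠ 0 ∧ v.val ≤ r}ᶜ, ?_, isPerfectCode_of_star ?_ ?_, ?_⟩
  · rw [hedge, Set.ncard_coe_finset, hE]
  · intro v hv hvr
    rw [fromEdgeSet_adj]
    exact ⟨hsE (Finset.mem_image.2 ⟨v, by simp [K, hv, hvr], rfl⟩), hv.symm⟩
  · intro u v huv
    rw [fromEdgeSet_adj] at huv
    exact (Finset.mem_filter.1 (hEK u v huv.1).1).2
  · have hcoe : {v : Fin n | v ≠ 0 ∧ v.val ≤ r} = (K.erase 0 : Finset (Fin n)) := by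
      ext v; simp [K, and_comm]
    rw [Set.ncard_compl, hcoe, Set.ncard_coe_finset, hT, Nat.card_eq_fintype_card,
      Fintype.card_fin]

theorem D_n_zero_m (n m r : ℕ) (hn : 2 ≤ n) (hm : m ≤ n.choose 2) (hr : 1 ≤ r)
    (h1 : r.choose 2 < m) (h2 : m ≤ (r + 1).choose 2) :
    (∀ (V : Type) [Fintype V] (G : SimpleGraph V), Fintype.card V = n →
        G.edgeSet.ncard = m → crNum G = 0 → gammaCR G ≤ n - r) ∧
    (∃ G : SimpleGraph (Fin n), G.edgeSet.ncard = m ∧ crNum G = 0 ∧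
        gammaCR G = n - r) := by
  have hlt : ∀ q, m ≤ q.choose 2 → r < q := fun q hq => by
    by_contra! hqr
    exact absurd (Nat.choose_le_choose 2 hqr) (by omega)
  constructor
  · intro V _ G hV hG hcr
    obtain ⟨S, hS⟩ := exists_isPerfectCode hcr
    have hq := hlt _ (hG ▸ hS.ncard_edgeSet_le)
    have hadd := Set.ncard_add_ncard_compl S
    rw [Nat.card_eq_fintype_card, hV] at hadd
    rw [hS.gammaCR_eq]
    omega
  · have hrm : r ≤ m := by
      have := le_choose_two_add_one r
      omega
    obtain ⟨G, S, hG, hS, hcard⟩ := exists_graph_isPerfectCode (hlt n hm) hrm h2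
    exact ⟨G, hG, hS.crNum_eq_zero, hS.gammaCR_eq.trans hcard⟩
end

section
/- Let n and m be integers with n ≥ 2 and 0 ≤ m ≤ C(n, 2). If 0 ≤ m < n − 1, then every finite simple graph G of order n with m edges and CR(G) = 0 satisfies γ_CR(G) ≥ n − m, and there exists such a graph with γ_CR(G) = n − m. If n − 1 ≤ m ≤ C(n, 2), then there exists a finite simple graph G of order n with m edges, CR(G) = 0, and γ_CR(G) = 1. In other words, d(n,0,m) = n − m if 0 ≤ m < n − 1, and d(n,0,m) = 1 if n − 1 ≤ m ≤ C(n, 2). -/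
open SimpleGraph Set

theorem IsDomSet.univ {V : Type*} (G : SimpleGraph V) : IsDomSet G Set.univ :=
  fun v => ⟨v, Set.mem_univ v, Set.mem_insert v _⟩

theorem exists_isDomSet_ncard_eq_gammaCR {V : Type*} (G : SimpleGraph V) :
    ∃ S : Set V, IsDomSet G S ∧ S.ncard = gammaCR G := by
  have hne : {k : ℕ | ∃ S : Set V, IsDomSet G S ∧ crOf G S = k}.Nonempty :=
    ⟨_, Set.univ, IsDomSet.univ G, rfl⟩
  obtain ⟨S, hS, hcr⟩ := Nat.sInf_mem hne
  have hne' : {r : ℕ | ∃ S : Set V, IsDomSet G S ∧ crOf G S = crNum G ∧ S.ncard = r}.Nonempty :=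
    ⟨_, S, hS, hcr, rfl⟩
  obtain ⟨T, hT, -, hcard⟩ := Nat.sInf_mem hne'
  exact ⟨T, hT, hcard⟩

/-- Sending each vertex outside a dominating set to an edge joining it to the set is injective. -/
theorem IsDomSet.card_le_ncard_add_ncard_edgeSet {V : Type*} [Fintype V] {G : SimpleGraph V}
    {S : Set V} (hS : IsDomSet G S) : Fintype.card V ≤ S.ncard + G.edgeSet.ncard := by
  choose f hfS hf using hS
  have hle : Sᶜ.ncard ≤ G.edgeSet.ncard := by
    refine Set.ncard_le_ncard_of_injOn (fun v => s(v, f v)) ?_ ?_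
    · intro v hv
      rcases hf v with h | h
      · exact absurd (h ▸ hfS v) hv
      · exact ((G.mem_neighborSet _ _).1 h).symm
    · intro v hv w hw h
      rcases Sym2.eq_iff.1 h with h | h
      · exact h.1
      · exact absurd (h.1 ▸ hfS w) hv
  have := Set.ncard_add_ncard_compl S
  rw [Nat.card_eq_fintype_card] at this
  lia

theorem card_sub_ncard_edgeSet_le_gammaCR {V : Type*} [Fintype V] (G : SimpleGraph V) :
    Fintype.card V - G.edgeSet.ncard ≤ gammaCR G := by
  obtain ⟨S, hS, hcard⟩ := exists_isDomSet_ncard_eq_gammaCR G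
  have := hS.card_le_ncard_add_ncard_edgeSet
  lia

theorem gammaCR_pos {V : Type*} [Finite V] [Nonempty V] (G : SimpleGraph V) :
    0 < gammaCR G := by
  obtain ⟨S, hS, hcard⟩ := exists_isDomSet_ncard_eq_gammaCR G
  obtain ⟨s, hs, -⟩ := hS (Classical.arbitrary V)
  exact hcard ▸ (Set.ncard_pos).2 ⟨s, hs⟩

/-- A dominating set meeting every closed neighborhood at most once overdominates no vertex. -/
theorem IsDomSet.crNum_eq_zero_and_gammaCR_le {V : Type*} {G : SimpleGraph V} {S : Set V}
    (hS : IsDomSet G S) (h : ∀ x, (closedNbhd G x ∩ S).Subsingleton) :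
    crNum G = 0 ∧ gammaCR G ≤ S.ncard := by
  have hcr : crOf G S = 0 := by
    have hempty : {x : V | 2 ≤ (closedNbhd G x ∩ S).ncard} = ∅ := by
      refine Set.eq_empty_of_forall_notMem fun x hx => ?_
      have := (Set.ncard_le_one (h x).finite).2 fun a ha b hb => h x ha hb
      have hx' : 2 ≤ (closedNbhd G x ∩ S).ncard := hx
      lia
    rw [crOf, hempty, Set.ncard_empty]
  have hnum : crNum G = 0 := Nat.le_zero.1 (Nat.sInf_le ⟨S, hS, hcr⟩)
  exact ⟨hnum, Nat.sInf_le ⟨S, hS, hcr.trans hnum.symm, rfl⟩⟩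

/-- The edges joining `0` to the vertices `1, …, k`. -/
def starEdges (N k : ℕ) : Set (Sym2 (Fin (N + 1))) :=
  (fun i : Fin N => s(0, i.succ)) '' {i | i.val < k}

theorem ncard_starEdges {N k : ℕ} (hk : k ≤ N) : (starEdges N k).ncard = k := by
  rw [starEdges, Set.ncard_image_of_injective]
  · rw [Set.ncard_eq_toFinset_card', Set.toFinset_ofPred, Fin.card_filter_val_lt, min_eq_right hk]
  · intro i j h
    simpa using h

theorem mk_mem_starEdges {N k : ℕ} {a b : Fin (N + 1)} :
    s(a, b) ∈ starEdges N k ↔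
      (a = 0 ∧ 0 < b.val ∧ b.val ≤ k) ∨ (b = 0 ∧ 0 < a.val ∧ a.val ≤ k) := by
  constructor
  · rintro ⟨i, hi, h⟩
    have hi' : i.val < k := hi
    rcases Sym2.eq_iff.1 h with ⟨rfl, rfl⟩ | ⟨rfl, rfl⟩ <;> simp <;> lia
  · rintro (⟨rfl, h0, hk⟩ | ⟨rfl, h0, hk⟩)
    · refine ⟨⟨b.val - 1, by lia⟩, show b.val - 1 < k by lia, ?_⟩
      exact congrArg (fun c => s(0, c)) (Fin.ext (by simp; lia))
    · refine ⟨⟨a.val - 1, by lia⟩, show a.val - 1 < k by lia, ?_⟩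
      exact (congrArg (fun c => s(0, c)) (Fin.ext (by simp; lia))).trans Sym2.eq_swap

theorem starEdges_subset_edgeSet_top (N k : ℕ) :
    starEdges N k ⊆ (⊤ : SimpleGraph (Fin (N + 1))).edgeSet := by
  rintro _ ⟨i, -, rfl⟩
  simpa using (Fin.succ_ne_zero i).symm

theorem edgeSet_fromEdgeSet_of_subset {V : Type*} {E : Set (Sym2 V)}
    (hE : E ⊆ (⊤ : SimpleGraph V).edgeSet) : (fromEdgeSet E).edgeSet = E := by
  rw [edgeSet_fromEdgeSet, sdiff_eq_left, Set.disjoint_left]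
  exact fun e he => by simpa using hE he

/-- The star with `m` leaves together with `N - m` isolated vertices. -/
theorem exists_gammaCR_eq_sub {N m : ℕ} (hm : m ≤ N) :
    ∃ G : SimpleGraph (Fin (N + 1)), G.edgeSet.ncard = m ∧ crNum G = 0 ∧
      gammaCR G = N + 1 - m := by
  have hedge := edgeSet_fromEdgeSet_of_subset (starEdges_subset_edgeSet_top N m)
  have hcard := (congrArg Set.ncard hedge).trans (ncard_starEdges hm)
  set G := fromEdgeSet (starEdges N m)
  have hadj (a b : Fin (N + 1)) : G.Adj a b ↔
      (a = 0 ∧ 0 < b.val ∧ b.val ≤ m) ∨ (b = 0 ∧ 0 < a.val ∧ a.val ≤ m) := by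
    rw [← mem_edgeSet, hedge, mk_mem_starEdges]
  set L : Set (Fin (N + 1)) := {v | 0 < v.val ∧ v.val ≤ m}
  have hdom : IsDomSet G Lᶜ := by
    intro v
    by_cases hv : v ∈ L
    · exact ⟨0, fun h => h.1.ne rfl, Or.inr ((hadj 0 v).2 (Or.inl ⟨rfl, hv⟩))⟩
    · exact ⟨v, hv, Or.inl rfl⟩
  have hone (x : Fin (N + 1)) : (closedNbhd G x ∩ Lᶜ).Subsingleton := by
    rintro a ⟨ha, haL⟩ b ⟨hb, hbL⟩
    simp only [closedNbhd, Set.mem_insert_iff, mem_neighborSet, hadj] at ha hb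
    simp only [L, Set.mem_compl_iff, Set.mem_ofPred_eq] at haL hbL
    grind
  obtain ⟨hnum, hle⟩ := hdom.crNum_eq_zero_and_gammaCR_le hone
  have hL : L.ncard = m := by
    have himage : L = Fin.succ '' {i : Fin N | i.val < m} := by
      ext v
      refine Fin.cases ?_ (fun i => ?_) v <;> simp [L]
    rw [himage, Set.ncard_image_of_injective _ (Fin.succ_injective N),
      Set.ncard_eq_toFinset_card', Set.toFinset_ofPred, Fin.card_filter_val_lt, min_eq_right hm]
  have hcompl := Set.ncard_add_ncard_compl L
  have hlower := card_sub_ncard_edgeSet_le_gammaCR G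
  rw [Nat.card_eq_fintype_card, Fintype.card_fin] at hcompl
  rw [hcard, Fintype.card_fin] at hlower
  exact ⟨G, hcard, hnum, by lia⟩

/-- A graph containing a spanning star is dominated by the center of the star. -/
theorem exists_gammaCR_eq_one {N m : ℕ} (hN : N ≤ m) (hm : m ≤ (N + 1).choose 2) :
    ∃ G : SimpleGraph (Fin (N + 1)), G.edgeSet.ncard = m ∧ crNum G = 0 ∧ gammaCR G = 1 := by
  have htop : (⊤ : SimpleGraph (Fin (N + 1))).edgeSet.ncard = (N + 1).choose 2 := by
    rw [← coe_edgeFinset, Set.ncard_coe_finset, card_edgeFinset_top_eq_card_choose_two,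
      Fintype.card_fin]
  obtain ⟨E, hstar, hE, hcard⟩ := Set.exists_subsuperset_card_eq
    (starEdges_subset_edgeSet_top N N) ((ncard_starEdges le_rfl).trans_le hN)
    (hm.trans_eq htop.symm)
  have hedge := edgeSet_fromEdgeSet_of_subset hE
  have hdom : IsDomSet (fromEdgeSet E) {0} := by
    refine fun v => ⟨0, rfl, ?_⟩
    by_cases hv : v = 0
    · exact Or.inl hv
    · refine Or.inr ((fromEdgeSet_adj E).2 ⟨hstar (mk_mem_starEdges.2 (Or.inl ?_)), Ne.symm hv⟩)
      exact ⟨rfl, Nat.pos_of_ne_zero fun h => hv (Fin.ext h), by lia⟩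
  obtain ⟨hnum, hle⟩ := hdom.crNum_eq_zero_and_gammaCR_le
    fun x => Set.subsingleton_singleton.anti Set.inter_subset_right
  rw [Set.ncard_singleton] at hle
  exact ⟨_, (congrArg Set.ncard hedge).trans hcard, hnum, le_antisymm hle (gammaCR_pos _)⟩

theorem d_n_zero_m (n m : ℕ) (hn : 2 ≤ n) (hm : m ≤ n.choose 2) :
    (m < n - 1 →
      (∀ (V : Type) [Fintype V] (G : SimpleGraph V), Fintype.card V = n →
          G.edgeSet.ncard = m → crNum G = 0 → n - m ≤ gammaCR G) ∧
      (∃ G : SimpleGraph (Fin n), G.edgeSet.ncard = m ∧ crNum G = 0 ∧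
          gammaCR G = n - m)) ∧
    (n - 1 ≤ m →
      ∃ G : SimpleGraph (Fin n), G.edgeSet.ncard = m ∧ crNum G = 0 ∧
          gammaCR G = 1) := by
  obtain ⟨N, rfl⟩ : ∃ N, n = N + 1 := ⟨n - 1, by lia⟩
  refine ⟨fun h => ⟨?_, exists_gammaCR_eq_sub (m := m) (by lia)⟩,
    fun h => exists_gammaCR_eq_one (by lia) hm⟩
  intro V _ G hV hG _
  rw [← hV, ← hG]
  exact card_sub_ncard_edgeSet_le_gammaCR G
end
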